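/- arXiv:2305.05069 — 4 statements merged into one kernel-verified Lean document; each statement's English description precedes it below -/
import Mathlib

section
/- Let d ≥ 1, let ξ ∈ ℝ^d be nonzero, let F₁', F₁'', F₂', F₂'' ∈ ℝ^d, and let σ', σ'' be real numbers with σ' > 0 and σ'' > 0. If |F₁|²·|F₂·ξ|² ≠ |F₂|²·|F₁·ξ|², then the 6×6 complex matrix M(ξ) is invertible (equivalently, injective as a linear map ℂ⁶ → ℂ⁶). -/
open Matrix Complex

/-- The 6×6 principal symbol matrix `M(ξ)` of the linearized complex-conductivity
inverse problem with `n = 2` experiments. Here `⬝ᵥ` is the Euclidean inner product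
on `ℝ^d`, so `ξ ⬝ᵥ ξ = |ξ|²`. -/
noncomputable def symbolM {d : ℕ} (ξ F₁' F₁'' F₂' F₂'' : Fin d → ℝ) (σ' σ'' : ℝ) :
    Matrix (Fin 6) (Fin 6) ℂ :=
  !![((F₁' ⬝ᵥ F₁' + F₁'' ⬝ᵥ F₁'' : ℝ) : ℂ), 0, ((2 * σ' * (F₁' ⬝ᵥ ξ) : ℝ) : ℂ) * I,
       ((2 * σ' * (F₁'' ⬝ᵥ ξ) : ℝ) : ℂ) * I, 0, 0;
     ((F₂' ⬝ᵥ F₂' + F₂'' ⬝ᵥ F₂'' : ℝ) : ℂ), 0, 0, 0, ((2 * σ' * (F₂' ⬝ᵥ ξ) : ℝ) : ℂ) * I,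
       ((2 * σ' * (F₂'' ⬝ᵥ ξ) : ℝ) : ℂ) * I;
     ((F₁' ⬝ᵥ ξ : ℝ) : ℂ) * I, -((F₁'' ⬝ᵥ ξ : ℝ) : ℂ) * I, ((-(σ' * (ξ ⬝ᵥ ξ)) : ℝ) : ℂ),
       ((σ'' * (ξ ⬝ᵥ ξ) : ℝ) : ℂ), 0, 0;
     ((F₁'' ⬝ᵥ ξ : ℝ) : ℂ) * I, ((F₁' ⬝ᵥ ξ : ℝ) : ℂ) * I, ((-(σ'' * (ξ ⬝ᵥ ξ)) : ℝ) : ℂ),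
       ((-(σ' * (ξ ⬝ᵥ ξ)) : ℝ) : ℂ), 0, 0;
     ((F₂' ⬝ᵥ ξ : ℝ) : ℂ) * I, -((F₂'' ⬝ᵥ ξ : ℝ) : ℂ) * I, 0, 0, ((-(σ' * (ξ ⬝ᵥ ξ)) : ℝ) : ℂ),
       ((σ'' * (ξ ⬝ᵥ ξ) : ℝ) : ℂ);
     ((F₂'' ⬝ᵥ ξ : ℝ) : ℂ) * I, ((F₂' ⬝ᵥ ξ : ℝ) : ℂ) * I, 0, 0, ((-(σ'' * (ξ ⬝ᵥ ξ)) : ℝ) : ℂ),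
       ((-(σ' * (ξ ⬝ᵥ ξ)) : ℝ) : ℂ)]

theorem symbolM_aux (A a b s t x v0 v1 v2 v3 : ℂ)
    (h1 : A * v0 + 2 * s * a * I * v2 + 2 * s * b * I * v3 = 0)
    (h3 : a * I * v0 - b * I * v1 - s * x * v2 + t * x * v3 = 0)
    (h4 : b * I * v0 + a * I * v1 - t * x * v2 - s * x * v3 = 0) :
    A * (x * (s ^ 2 + t ^ 2)) * v0 - 2 * s * (a ^ 2 + b ^ 2) * (s * v0 + t * v1) = 0 := by
  have hI : I * I = -1 := I_mul_I
  linear_combination (x * (s ^ 2 + t ^ 2)) * h1 + 2 * s * I * (a * s - b * t) * h3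
    + 2 * s * I * (a * t + b * s) * h4
    - 2 * s * (a ^ 2 + b ^ 2) * (s * v0 + t * v1) * hI

theorem symbolM_aux2 (a b s t x v2 v3 : ℂ) (hx : x * (s ^ 2 + t ^ 2) ≠ 0)
    (h3 : a * I * 0 - b * I * 0 - s * x * v2 + t * x * v3 = 0)
    (h4 : b * I * 0 + a * I * 0 - t * x * v2 - s * x * v3 = 0) : v2 = 0 ∧ v3 = 0 := by
  constructor
  · apply (mul_eq_zero.mp (_ : (x * (s ^ 2 + t ^ 2)) * v2 = 0)).resolve_left hx
    linear_combination -s * h3 - t * h4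
  · apply (mul_eq_zero.mp (_ : (x * (s ^ 2 + t ^ 2)) * v3 = 0)).resolve_left hx
    linear_combination t * h3 - s * h4

/-- If `|F₁|²·|F₂·ξ|² ≠ |F₂|²·|F₁·ξ|²`, `σ' > 0`, `σ'' > 0` and `ξ ≠ 0`, then the
principal symbol `M(ξ)` is invertible (equivalently, injective as a map `ℂ⁶ → ℂ⁶`). -/
theorem symbolM_isUnit {d : ℕ} (hd : 1 ≤ d) (ξ F₁' F₁'' F₂' F₂'' : Fin d → ℝ) (hξ : ξ ≠ 0)
    (σ' σ'' : ℝ) (hσ' : 0 < σ') (hσ'' : 0 < σ'')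
    (h : (F₁' ⬝ᵥ F₁' + F₁'' ⬝ᵥ F₁'') * ((F₂' ⬝ᵥ ξ) ^ 2 + (F₂'' ⬝ᵥ ξ) ^ 2) ≠
         (F₂' ⬝ᵥ F₂' + F₂'' ⬝ᵥ F₂'') * ((F₁' ⬝ᵥ ξ) ^ 2 + (F₁'' ⬝ᵥ ξ) ^ 2)) :
    IsUnit (symbolM ξ F₁' F₁'' F₂' F₂'' σ' σ'') ∧
      Function.Injective (symbolM ξ F₁' F₁'' F₂' F₂'' σ' σ'').mulVec := by
  have hx : ξ ⬝ᵥ ξ ≠ 0 := fun h0 => hξ (dotProduct_self_eq_zero.mp h0)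
  have hinj : Function.Injective (symbolM ξ F₁' F₁'' F₂' F₂'' σ' σ'').mulVec := by
    rw [← Matrix.coe_mulVecLin, ← LinearMap.ker_eq_bot, LinearMap.ker_eq_bot']
    intro v hv
    rw [Matrix.coe_mulVecLin] at hv
    have e0 := congrFun hv 0
    have e1 := congrFun hv 1
    have e2 := congrFun hv 2
    have e3 := congrFun hv 3
    have e4 := congrFun hv 4
    have e5 := congrFun hv 5
    clear hv hξ
    simp only [symbolM] at e0 e1 e2 e3 e4 e5
    generalize F₁' ⬝ᵥ F₁' + F₁'' ⬝ᵥ F₁'' = A at *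
    generalize F₂' ⬝ᵥ F₂' + F₂'' ⬝ᵥ F₂'' = B at *
    generalize F₁' ⬝ᵥ ξ = a at *
    generalize F₁'' ⬝ᵥ ξ = b at *
    generalize F₂' ⬝ᵥ ξ = c at *
    generalize F₂'' ⬝ᵥ ξ = e at *
    generalize ξ ⬝ᵥ ξ = x at *
    simp [Matrix.mulVec, dotProduct, Fin.sum_univ_six] at e0 e1 e2 e3 e4 e5
    have hN : (x : ℂ) * ((σ' : ℂ) ^ 2 + (σ'' : ℂ) ^ 2) ≠ 0 := by
      have : x * (σ' ^ 2 + σ'' ^ 2) ≠ 0 := mul_ne_zero hx (by positivity)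
      exact_mod_cast this
    have hs : (σ' : ℂ) ≠ 0 := by exact_mod_cast hσ'.ne'
    have ht : (σ'' : ℂ) ≠ 0 := by exact_mod_cast hσ''.ne'
    have hD : (A : ℂ) * ((c : ℂ) ^ 2 + (e : ℂ) ^ 2) - B * ((a : ℂ) ^ 2 + (b : ℂ) ^ 2) ≠ 0 := by
      have := sub_ne_zero.mpr h
      exact_mod_cast this
    have k1 := symbolM_aux A a b σ' σ'' x (v 0) (v 1) (v 2) (v 3)
      (by linear_combination e0) (by linear_combination e2) (by linear_combination e3)
    have k2 := symbolM_aux B c e σ' σ'' x (v 0) (v 1) (v 4) (v 5)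
      (by linear_combination e1) (by linear_combination e4) (by linear_combination e5)
    have v0 : v 0 = 0 := by
      apply (mul_eq_zero.mp (_ : (((A : ℂ) * ((c : ℂ) ^ 2 + (e : ℂ) ^ 2)
        - B * ((a : ℂ) ^ 2 + (b : ℂ) ^ 2)) * ((x : ℂ) * ((σ' : ℂ) ^ 2 + (σ'' : ℂ) ^ 2)))
        * v 0 = 0)).resolve_left (mul_ne_zero hD hN)
      linear_combination ((c : ℂ) ^ 2 + (e : ℂ) ^ 2) * k1 - ((a : ℂ) ^ 2 + (b : ℂ) ^ 2) * k2
    rw [v0] at k1 k2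
    have v1 : v 1 = 0 := by
      apply (mul_eq_zero.mp (_ : (((A : ℂ) * ((c : ℂ) ^ 2 + (e : ℂ) ^ 2)
        - B * ((a : ℂ) ^ 2 + (b : ℂ) ^ 2)) * (2 * σ' * σ'')) * v 1 = 0)).resolve_left
        (mul_ne_zero hD (mul_ne_zero (mul_ne_zero two_ne_zero hs) ht))
      linear_combination B * k1 - A * k2
    rw [v0, v1] at e2 e3 e4 e5
    obtain ⟨v2, v3⟩ := symbolM_aux2 a b σ' σ'' x (v 2) (v 3) hN
      (by linear_combination e2) (by linear_combination e3)
    obtain ⟨v4, v5⟩ := symbolM_aux2 c e σ' σ'' x (v 4) (v 5) hN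
      (by linear_combination e4) (by linear_combination e5)
    funext i
    fin_cases i <;> assumption
  exact ⟨Matrix.mulVec_injective_iff_isUnit.mp hinj, hinj⟩
end

section
/- Let d ≥ 1, n ≥ 2, let ξ ∈ ℝ^d be nonzero, let F_j', F_j'' ∈ ℝ^d for j = 1, …, n, and let σ', σ'' be real numbers with σ' > 0 and σ'' > 0. If there exist indices i ≠ j in {1, …, n} such that |F_i|²·|F_j·ξ|² ≠ |F_j|²·|F_i·ξ|², then the 3n × (2n+2) complex matrix Ã₀(ξ) is injective as a linear map ℂ^(2n+2) → ℂ^(3n). -/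
open Matrix Complex

/-- The `3n × (2n+2)` principal symbol matrix `Ã₀(ξ)` of the linearized
complex-conductivity inverse problem with `n` experiments. The rows come in triples
indexed by `j`: rows `3j`, `3j+1`, `3j+2` (0-indexed). In the `j`-th triple, the first
two columns of the three rows are `(|F_j|², 0)`, `((F_j'·ξ)i, −(F_j''·ξ)i)` and
`((F_j''·ξ)i, (F_j'·ξ)i)`; the columns `2j+2` and `2j+3` (0-indexed) of the three rows
are `(2σ'(F_j'·ξ)i, 2σ'(F_j''·ξ)i)`, `(−σ'|ξ|², σ''|ξ|²)` and `(−σ''|ξ|², −σ'|ξ|²)`;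
all other entries vanish. Here `⬝ᵥ` is the Euclidean inner product, `ξ ⬝ᵥ ξ = |ξ|²`. -/
noncomputable def symbolA {d n : ℕ} (ξ : Fin d → ℝ) (F' F'' : Fin n → Fin d → ℝ)
    (σ' σ'' : ℝ) : Matrix (Fin (3 * n)) (Fin (2 * n + 2)) ℂ :=
  fun r c =>
    let j : Fin n := ⟨(r : ℕ) / 3, by have := r.isLt; omega⟩
    let i : ℕ := (r : ℕ) % 3
    if (c : ℕ) = 0 then
      if i = 0 then ((F' j ⬝ᵥ F' j + F'' j ⬝ᵥ F'' j : ℝ) : ℂ)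
      else if i = 1 then ((F' j ⬝ᵥ ξ : ℝ) : ℂ) * I
      else ((F'' j ⬝ᵥ ξ : ℝ) : ℂ) * I
    else if (c : ℕ) = 1 then
      if i = 0 then 0
      else if i = 1 then -((F'' j ⬝ᵥ ξ : ℝ) : ℂ) * I
      else ((F' j ⬝ᵥ ξ : ℝ) : ℂ) * I
    else if (c : ℕ) = 2 * (j : ℕ) + 2 then
      if i = 0 then ((2 * σ' * (F' j ⬝ᵥ ξ) : ℝ) : ℂ) * I
      else if i = 1 then ((-(σ' * (ξ ⬝ᵥ ξ)) : ℝ) : ℂ)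
      else ((-(σ'' * (ξ ⬝ᵥ ξ)) : ℝ) : ℂ)
    else if (c : ℕ) = 2 * (j : ℕ) + 3 then
      if i = 0 then ((2 * σ' * (F'' j ⬝ᵥ ξ) : ℝ) : ℂ) * I
      else if i = 1 then ((σ'' * (ξ ⬝ᵥ ξ) : ℝ) : ℂ)
      else ((-(σ' * (ξ ⬝ᵥ ξ)) : ℝ) : ℂ)
    else 0

theorem symbolA_row {d n : ℕ} (ξ : Fin d → ℝ) (F' F'' : Fin n → Fin d → ℝ)
    (σ' σ'' : ℝ) (x : Fin (2 * n + 2) → ℂ) (j : Fin n) (k : ℕ) (hk : k < 3) :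
    (symbolA ξ F' F'' σ' σ'').mulVec x ⟨3 * j + k, by have := j.isLt; omega⟩ =
      (if k = 0 then ((F' j ⬝ᵥ F' j + F'' j ⬝ᵥ F'' j : ℝ) : ℂ)
      else if k = 1 then ((F' j ⬝ᵥ ξ : ℝ) : ℂ) * I
      else ((F'' j ⬝ᵥ ξ : ℝ) : ℂ) * I) * x ⟨0, by omega⟩ +
      (if k = 0 then 0
      else if k = 1 then -((F'' j ⬝ᵥ ξ : ℝ) : ℂ) * I
      else ((F' j ⬝ᵥ ξ : ℝ) : ℂ) * I) * x ⟨1, by omega⟩ +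
      (if k = 0 then ((2 * σ' * (F' j ⬝ᵥ ξ) : ℝ) : ℂ) * I
      else if k = 1 then ((-(σ' * (ξ ⬝ᵥ ξ)) : ℝ) : ℂ)
      else ((-(σ'' * (ξ ⬝ᵥ ξ)) : ℝ) : ℂ)) * x ⟨2 * j + 2, by have := j.isLt; omega⟩ +
      (if k = 0 then ((2 * σ' * (F'' j ⬝ᵥ ξ) : ℝ) : ℂ) * I
      else if k = 1 then ((σ'' * (ξ ⬝ᵥ ξ) : ℝ) : ℂ)
      else ((-(σ' * (ξ ⬝ᵥ ξ)) : ℝ) : ℂ)) * x ⟨2 * j + 3, by have := j.isLt; omega⟩ := by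
  have hj := j.isLt
  have e1 : (⟨(3 * (j : ℕ) + k) / 3, by omega⟩ : Fin n) = j := by
    apply Fin.ext
    change (3 * (j : ℕ) + k) / 3 = j
    omega
  have e1' : (3 * (j : ℕ) + k) / 3 = j := by omega
  have e2 : (3 * (j : ℕ) + k) % 3 = k := by omega
  change ∑ c, symbolA ξ F' F'' σ' σ'' ⟨3 * j + k, by omega⟩ c * x c = _
  rw [← Finset.sum_subset (Finset.subset_univ
    ({⟨0, by omega⟩, ⟨1, by omega⟩, ⟨2 * j + 2, by omega⟩, ⟨2 * j + 3, by omega⟩} :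
      Finset (Fin (2 * n + 2))))]
  · rw [Finset.sum_insert, Finset.sum_insert, Finset.sum_insert, Finset.sum_singleton]
    · simp only [symbolA, e1', e2]
      simp [add_assoc]
    all_goals simp [Fin.ext_iff]
  · intro c _ hc
    simp only [Finset.mem_insert, Finset.mem_singleton, Fin.ext_iff, not_or] at hc
    obtain ⟨h0, h1, h2, h3⟩ := hc
    simp only [symbolA, e1', h0, h1, h2, h3, if_false, zero_mul]

theorem symbolA_elim (N a b X p q s t u v : ℂ)
    (E1 : N * s + 2 * p * a * I * u + 2 * p * b * I * v = 0)
    (E2 : a * I * s + -b * I * t + -(p * X) * u + q * X * v = 0)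
    (E3 : b * I * s + a * I * t + -(q * X) * u + -(p * X) * v = 0) :
    N * ((p ^ 2 + q ^ 2) * X * s) = (a ^ 2 + b ^ 2) * (2 * p * (p * s + q * t)) := by
  linear_combination ((p ^ 2 + q ^ 2) * X) * E1 + 2 * p * I * ((a * p - b * q) * E2
    + (a * q + b * p) * E3) - 2 * p * (a ^ 2 + b ^ 2) * (p * s + q * t) * I_sq

/-- If `σ' > 0`, `σ'' > 0`, `ξ ≠ 0` and there exist two experiments `i ≠ j` with
`|F_i|²·|F_j·ξ|² ≠ |F_j|²·|F_i·ξ|²`, then the principal symbol `Ã₀(ξ)` is injective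
as a linear map `ℂ^(2n+2) → ℂ^(3n)`. -/
theorem symbolA_injective {d n : ℕ} (hd : 1 ≤ d) (hn : 2 ≤ n) (ξ : Fin d → ℝ)
    (hξ : ξ ≠ 0) (F' F'' : Fin n → Fin d → ℝ) (σ' σ'' : ℝ)
    (hσ' : 0 < σ') (hσ'' : 0 < σ'')
    (h : ∃ i j : Fin n, i ≠ j ∧
      (F' i ⬝ᵥ F' i + F'' i ⬝ᵥ F'' i) * ((F' j ⬝ᵥ ξ) ^ 2 + (F'' j ⬝ᵥ ξ) ^ 2) ≠
      (F' j ⬝ᵥ F' j + F'' j ⬝ᵥ F'' j) * ((F' i ⬝ᵥ ξ) ^ 2 + (F'' i ⬝ᵥ ξ) ^ 2)) :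
    Function.Injective (symbolA ξ F' F'' σ' σ'').mulVec := by
  have hX : 0 < ξ ⬝ᵥ ξ := by
    rcases (dotProduct_self_star_nonneg ξ).lt_or_eq with h1 | h1
    · simpa using h1
    · exact absurd (dotProduct_self_eq_zero.1 (by simpa using h1.symm)) hξ
  have key : ∀ x, (symbolA ξ F' F'' σ' σ'').mulVec x = 0 → x = 0 := by
    intro x hx
    have R : ∀ (j : Fin n) (k : ℕ) (hk : k < 3), _ = (0 : ℂ) := fun j k hk =>
      (symbolA_row ξ F' F'' σ' σ'' x j k hk).symm.trans (congrFun hx _)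
    set s := x 0 with hs
    set t := x 1 with ht
    have E1 := fun j => R j 0 (by norm_num)
    have E2 := fun j => R j 1 (by norm_num)
    have E3 := fun j => R j 2 (by norm_num)
    simp at E1 E2 E3
    have hXc : ((ξ ⬝ᵥ ξ : ℝ) : ℂ) ≠ 0 := by exact_mod_cast hX.ne'
    have hp : (σ' : ℂ) ≠ 0 := by exact_mod_cast hσ'.ne'
    have hq : (σ'' : ℂ) ≠ 0 := by exact_mod_cast hσ''.ne'
    have hpq : (σ' : ℂ) ^ 2 + (σ'' : ℂ) ^ 2 ≠ 0 := by
      have : σ' ^ 2 + σ'' ^ 2 ≠ 0 := by positivity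
      exact_mod_cast this
    have L : ∀ j, ((F' j ⬝ᵥ F' j + F'' j ⬝ᵥ F'' j : ℝ) : ℂ) *
        (((σ' : ℂ) ^ 2 + (σ'' : ℂ) ^ 2) * ((ξ ⬝ᵥ ξ : ℝ) : ℂ) * s) =
        (((F' j ⬝ᵥ ξ : ℝ) : ℂ) ^ 2 + ((F'' j ⬝ᵥ ξ : ℝ) : ℂ) ^ 2) *
          (2 * σ' * (σ' * s + σ'' * t)) := by
      intro j
      apply symbolA_elim _ _ _ _ _ _ _ _ (x ⟨2 * j + 2, by have := j.isLt; omega⟩)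
        (x ⟨2 * j + 3, by have := j.isLt; omega⟩)
      · have := E1 j
        push_cast
        linear_combination this
      · linear_combination E2 j
      · linear_combination E3 j
    obtain ⟨i, j, -, hij⟩ := h
    have hijc : ((F' i ⬝ᵥ F' i + F'' i ⬝ᵥ F'' i : ℝ) : ℂ) *
        (((F' j ⬝ᵥ ξ : ℝ) : ℂ) ^ 2 + ((F'' j ⬝ᵥ ξ : ℝ) : ℂ) ^ 2) -
        ((F' j ⬝ᵥ F' j + F'' j ⬝ᵥ F'' j : ℝ) : ℂ) *
        (((F' i ⬝ᵥ ξ : ℝ) : ℂ) ^ 2 + ((F'' i ⬝ᵥ ξ : ℝ) : ℂ) ^ 2) ≠ 0 := by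
      rw [sub_ne_zero]
      exact_mod_cast hij
    have Li := L i
    have Lj := L j
    have hs0 : ((σ' : ℂ) ^ 2 + (σ'' : ℂ) ^ 2) * ((ξ ⬝ᵥ ξ : ℝ) : ℂ) * s = 0 := by
      refine (mul_eq_zero.1 ?_).resolve_left hijc
      linear_combination (((F' j ⬝ᵥ ξ : ℝ) : ℂ) ^ 2 + ((F'' j ⬝ᵥ ξ : ℝ) : ℂ) ^ 2) * Li
        - (((F' i ⬝ᵥ ξ : ℝ) : ℂ) ^ 2 + ((F'' i ⬝ᵥ ξ : ℝ) : ℂ) ^ 2) * Lj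
    have ht0 : 2 * (σ' : ℂ) * (σ' * s + σ'' * t) = 0 := by
      refine (mul_eq_zero.1 ?_).resolve_left hijc
      linear_combination ((F' j ⬝ᵥ F' j + F'' j ⬝ᵥ F'' j : ℝ) : ℂ) * Li
        - ((F' i ⬝ᵥ F' i + F'' i ⬝ᵥ F'' i : ℝ) : ℂ) * Lj
    have s0 : s = 0 := (mul_eq_zero.1 hs0).resolve_left (mul_ne_zero hpq hXc)
    have t0 : t = 0 := by
      have := (mul_eq_zero.1 ht0).resolve_left (mul_ne_zero two_ne_zero hp)
      rw [s0, mul_zero, zero_add] at this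
      exact (mul_eq_zero.1 this).resolve_left hq
    have D := mul_ne_zero hpq hXc
    have U : ∀ j : Fin n, x ⟨2 * j + 2, by have := j.isLt; omega⟩ = 0 := by
      intro j
      have e2 := E2 j
      have e3 := E3 j
      rw [← hs, ← ht, s0, t0] at e2 e3
      refine (mul_eq_zero.1 ?_).resolve_left D
      linear_combination -(σ' : ℂ) * e2 - (σ'' : ℂ) * e3
    have V : ∀ j : Fin n, x ⟨2 * j + 3, by have := j.isLt; omega⟩ = 0 := by
      intro j
      have e2 := E2 j
      have e3 := E3 j
      rw [← hs, ← ht, s0, t0] at e2 e3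
      refine (mul_eq_zero.1 ?_).resolve_left D
      linear_combination (σ'' : ℂ) * e2 - (σ' : ℂ) * e3
    funext ⟨c, hc⟩
    by_cases c0 : c = 0
    · subst c0; exact s0
    by_cases c1 : c = 1
    · subst c1; exact t0
    rcases Nat.even_or_odd' c with ⟨m, hm | hm⟩
    · have := U ⟨m - 1, by omega⟩
      have e : 2 * (m - 1) + 2 = c := by omega
      simpa only [e, Pi.zero_apply] using this
    · have := V ⟨m - 1, by omega⟩
      have e : 2 * (m - 1) + 3 = c := by omega
      simpa only [e, Pi.zero_apply] using this
  intro x y hxy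
  have := key (x - y) (by
    rw [Matrix.mulVec_sub]
    exact sub_eq_zero.2 hxy)
  exact sub_eq_zero.1 this
end

section
/- Let d ≥ 1, let ξ ∈ ℝ^d, let F₁', F₁'', F₂', F₂'' ∈ ℝ^d, and let σ', σ'' be real numbers. If σ' = 0 or σ'' = 0, then the 6×6 complex matrix M(ξ) is not invertible, i.e., its determinant vanishes (so the principal symbol of the linearized complex-conductivity problem with n = 2 experiments is not injective). -/
open Matrix Complex

/-- If `σ' = 0` or `σ'' = 0`, then the principal symbol `M(ξ)` of the linearized
complex-conductivity problem with `n = 2` experiments is not invertible: its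
determinant vanishes, so it is not injective. -/
theorem symbolM_det_eq_zero {d : ℕ} (hd : 1 ≤ d) (ξ F₁' F₁'' F₂' F₂'' : Fin d → ℝ)
    (σ' σ'' : ℝ) (hσ : σ' = 0 ∨ σ'' = 0) :
    (symbolM ξ F₁' F₁'' F₂' F₂'' σ' σ'').det = 0 ∧
      ¬ Function.Injective (symbolM ξ F₁' F₁'' F₂' F₂'' σ' σ'').mulVec := by
  have key : (symbolM ξ F₁' F₁'' F₂' F₂'' σ' σ'').det = 0 := by
    by_cases h0 : σ' = 0
    · subst h0
      apply Matrix.exists_vecMul_eq_zero_iff.mp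
      by_cases hN : ((F₁' ⬝ᵥ F₁' + F₁'' ⬝ᵥ F₁'' : ℝ) : ℂ) = 0
      · refine ⟨![1, 0, 0, 0, 0, 0], fun h => by simpa using congrFun h 0, ?_⟩
        ext j
        simp only [symbolM, hN]
        fin_cases j <;> simp [Matrix.vecMul, dotProduct, Fin.sum_univ_succ]
      · refine ⟨![((F₂' ⬝ᵥ F₂' + F₂'' ⬝ᵥ F₂'' : ℝ) : ℂ),
          -((F₁' ⬝ᵥ F₁' + F₁'' ⬝ᵥ F₁'' : ℝ) : ℂ), 0, 0, 0, 0],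
          fun h => hN (neg_eq_zero.mp (congrFun h 1)), ?_⟩
        unfold symbolM
        generalize ((F₁' ⬝ᵥ F₁' + F₁'' ⬝ᵥ F₁'' : ℝ) : ℂ) = N
        generalize ((F₂' ⬝ᵥ F₂' + F₂'' ⬝ᵥ F₂'' : ℝ) : ℂ) = K
        ext j
        fin_cases j <;> simp [Matrix.vecMul, dotProduct, Fin.sum_univ_succ] <;> ring
    · have h1 : σ'' = 0 := hσ.resolve_left h0
      subst h1
      apply Matrix.exists_mulVec_eq_zero_iff.mp
      by_cases hξ : ξ = 0
      · subst hξ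
        refine ⟨![0, 1, 0, 0, 0, 0], fun h => by simpa using congrFun h 1, ?_⟩
        ext j
        fin_cases j <;> simp [symbolM, Matrix.mulVec, dotProduct, Fin.sum_univ_succ]
      · have hs : ξ ⬝ᵥ ξ ≠ 0 := fun h => hξ (dotProduct_self_eq_zero.mp h)
        unfold symbolM
        generalize ξ ⬝ᵥ ξ = s at *
        generalize F₁' ⬝ᵥ ξ = a
        generalize F₁'' ⬝ᵥ ξ = b
        generalize F₂' ⬝ᵥ ξ = c
        generalize F₂'' ⬝ᵥ ξ = e
        generalize F₁' ⬝ᵥ F₁' + F₁'' ⬝ᵥ F₁'' = N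
        generalize F₂' ⬝ᵥ F₂' + F₂'' ⬝ᵥ F₂'' = K
        refine ⟨![0, (σ' : ℂ) * s, -b * I, a * I, -e * I, c * I], fun h => ?_, ?_⟩
        · have := congrFun h 1
          simp [h0, hs] at this
        · ext j
          fin_cases j <;> simp [Matrix.mulVec, dotProduct, Fin.sum_univ_succ] <;> ring
  refine ⟨key, fun hinj => ?_⟩
  obtain ⟨v, hv, hv0⟩ := Matrix.exists_mulVec_eq_zero_iff.mpr key
  exact hv (hinj (by rw [hv0, Matrix.mulVec_zero]))
end

section
/- Let d ≥ 1, let ξ ∈ ℝ^d be nonzero, let F₁', F₁'', F₂', F₂'' ∈ ℝ^d, and let σ', σ'' be real numbers with (σ', σ'') ≠ (0, 0). Write M(ξ) in 2×2 block form with top-left block A (rows 1–2, columns 1–2), top-right block B (rows 1–2, columns 3–6), bottom-left block C (rows 3–6, columns 1–2), and bottom-right block D (rows 3–6, columns 3–6). Then D is invertible and the determinant of the Schur complement A − B D⁻¹ C equals (2σ'σ'' / ((σ'² + σ''²)·|ξ|²)) · (|F₂|²·|F₁·ξ|² − |F₁|²·|F₂·ξ|²). -/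
open Matrix Complex

/-- Embedding of the first two row/column indices of a 6×6 matrix. -/
def blockTop : Fin 2 → Fin 6 := fun i => ⟨(i : ℕ), by omega⟩

/-- Embedding of the last four row/column indices of a 6×6 matrix. -/
def blockBot : Fin 4 → Fin 6 := fun i => ⟨(i : ℕ) + 2, by omega⟩

/-- Writing `M(ξ)` in block form with `A` the top-left 2×2 block, `B` the top-right
2×4 block, `C` the bottom-left 4×2 block and `D` the bottom-right 4×4 block: if
`ξ ≠ 0` and `(σ', σ'') ≠ (0, 0)`, then `D` is invertible and the determinant of the
Schur complement `A - B D⁻¹ C` equals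
`(2σ'σ'' / ((σ'² + σ''²)·|ξ|²)) · (|F₂|²·|F₁·ξ|² − |F₁|²·|F₂·ξ|²)`. -/
theorem symbolM_schur_det {d : ℕ} (hd : 1 ≤ d) (ξ F₁' F₁'' F₂' F₂'' : Fin d → ℝ)
    (hξ : ξ ≠ 0) (σ' σ'' : ℝ) (hσ : (σ', σ'') ≠ (0, 0)) :
    letI M := symbolM ξ F₁' F₁'' F₂' F₂'' σ' σ''
    letI A := M.submatrix blockTop blockTop
    letI B := M.submatrix blockTop blockBot
    letI C := M.submatrix blockBot blockTop
    letI D := M.submatrix blockBot blockBot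
    IsUnit D ∧
      (A - B * D⁻¹ * C).det =
        ((2 * σ' * σ'' / ((σ' ^ 2 + σ'' ^ 2) * (ξ ⬝ᵥ ξ)) *
          ((F₂' ⬝ᵥ F₂' + F₂'' ⬝ᵥ F₂'') * ((F₁' ⬝ᵥ ξ) ^ 2 + (F₁'' ⬝ᵥ ξ) ^ 2) -
           (F₁' ⬝ᵥ F₁' + F₁'' ⬝ᵥ F₁'') * ((F₂' ⬝ᵥ ξ) ^ 2 + (F₂'' ⬝ᵥ ξ) ^ 2)) : ℝ) : ℂ) := by
  have hk : (ξ ⬝ᵥ ξ) ≠ 0 := fun h => hξ (dotProduct_self_eq_zero.mp h)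
  have hs : σ' ^ 2 + σ'' ^ 2 ≠ 0 := by
    intro h
    apply hσ
    have h1 : σ' = 0 := by nlinarith [sq_nonneg σ', sq_nonneg σ'']
    have h2 : σ'' = 0 := by nlinarith [sq_nonneg σ', sq_nonneg σ'']
    rw [h1, h2]
  unfold symbolM
  generalize ξ ⬝ᵥ ξ = k at *
  generalize F₁' ⬝ᵥ ξ = a₁
  generalize F₁'' ⬝ᵥ ξ = b₁
  generalize F₂' ⬝ᵥ ξ = a₂
  generalize F₂'' ⬝ᵥ ξ = b₂
  generalize F₁' ⬝ᵥ F₁' + F₁'' ⬝ᵥ F₁'' = P₁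
  generalize F₂' ⬝ᵥ F₂' + F₂'' ⬝ᵥ F₂'' = P₂
  have hkC : (k : ℂ) ≠ 0 := by exact_mod_cast hk
  have hsC : (σ' : ℂ) ^ 2 + (σ'' : ℂ) ^ 2 ≠ 0 := by exact_mod_cast hs
  generalize hA0 : Matrix.submatrix _ blockTop blockTop = A
  generalize hB0 : Matrix.submatrix _ blockTop blockBot = B
  generalize hC0 : Matrix.submatrix _ blockBot blockTop = C
  generalize hD0 : Matrix.submatrix _ blockBot blockBot = D
  obtain ⟨u, hu⟩ : ∃ u : ℂ, u * (((σ' : ℂ) ^ 2 + (σ'' : ℂ) ^ 2) * k) = 1 :=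
    ⟨_, inv_mul_cancel₀ (mul_ne_zero hsC hkC)⟩
  have hu' : u = (((σ' : ℂ) ^ 2 + (σ'' : ℂ) ^ 2) * k)⁻¹ := eq_inv_of_mul_eq_one_left hu
  have hA : A = !![(P₁ : ℂ), 0; (P₂ : ℂ), 0] := by
    rw [← hA0]
    ext i j; fin_cases i <;> fin_cases j <;> rfl
  have hB : B = !![((2 * σ' * a₁ : ℝ) : ℂ) * I, ((2 * σ' * b₁ : ℝ) : ℂ) * I, 0, 0;
      0, 0, ((2 * σ' * a₂ : ℝ) : ℂ) * I, ((2 * σ' * b₂ : ℝ) : ℂ) * I] := by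
    rw [← hB0]
    ext i j; fin_cases i <;> fin_cases j <;> rfl
  have hC : C = !![(a₁ : ℂ) * I, -(b₁ : ℂ) * I; (b₁ : ℂ) * I, (a₁ : ℂ) * I;
      (a₂ : ℂ) * I, -(b₂ : ℂ) * I; (b₂ : ℂ) * I, (a₂ : ℂ) * I] := by
    rw [← hC0]
    ext i j; fin_cases i <;> fin_cases j <;> rfl
  have hD : D = !![((-(σ' * k) : ℝ) : ℂ), ((σ'' * k : ℝ) : ℂ), 0, 0;
      ((-(σ'' * k) : ℝ) : ℂ), ((-(σ' * k) : ℝ) : ℂ), 0, 0;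
      0, 0, ((-(σ' * k) : ℝ) : ℂ), ((σ'' * k : ℝ) : ℂ);
      0, 0, ((-(σ'' * k) : ℝ) : ℂ), ((-(σ' * k) : ℝ) : ℂ)] := by
    rw [← hD0]
    ext i j; fin_cases i <;> fin_cases j <;> rfl
  have hDE : D * !![-u * σ', -u * σ'', 0, 0; u * σ'', -u * σ', 0, 0;
      0, 0, -u * σ', -u * σ''; 0, 0, u * σ'', -u * σ'] = 1 := by
    rw [hD]
    ext i j
    fin_cases i <;> fin_cases j <;>
      simp [Matrix.mul_apply, Fin.sum_univ_succ] <;> first | ring1 | linear_combination hu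
  refine ⟨IsUnit.of_mul_eq_one _ hDE, ?_⟩
  rw [Matrix.inv_eq_right_inv hDE, hA, hB, hC, Matrix.det_fin_two]
  push_cast
  rw [div_eq_mul_inv, ← hu']
  simp [Matrix.mul_apply, Fin.sum_univ_succ]
  ring_nf
  simp only [I_sq, I_pow_four]
  ring
end
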